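/- arXiv:1908.10106 — 2 statements merged into one kernel-verified Lean document; each statement's English description precedes it below -/
import Mathlib

section
/- Let w₁ = a + ib and w₂ = ω be complex numbers with ω ≥ 0 real, and suppose |w₁² - w₂²| ≤ ε for some ε > 0. Then either |w₁ - w₂| ≤ 3√ε, or else |w₁| ≥ √ε, a < 0, and ω > 0. -/
open Complex

/-- Nitsche's elementary lemma: if `w₁ = a + ib` and `w₂ = ω ≥ 0` (real) satisfy
`|w₁² - w₂²| ≤ ε`, then either `|w₁ - w₂| ≤ 3√ε`, or `|w₁| ≥ √ε`, `a < 0` and `ω > 0`. -/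
theorem stmt_3 (w₁ : ℂ) (ω ε : ℝ) (hω : 0 ≤ ω) (hε : 0 < ε)
    (h : ‖w₁ ^ 2 - (ω : ℂ) ^ 2‖ ≤ ε) :
    ‖w₁ - (ω : ℂ)‖ ≤ 3 * Real.sqrt ε ∨
      (Real.sqrt ε ≤ ‖w₁‖ ∧ w₁.re < 0 ∧ 0 < ω) := by
  by_cases hc : ‖w₁ - (ω : ℂ)‖ ≤ 3 * Real.sqrt ε
  · exact Or.inl hc
  right
  push Not at hc
  have hs : 0 < Real.sqrt ε := Real.sqrt_pos.mpr hε
  have hss : Real.sqrt ε * Real.sqrt ε = ε := Real.mul_self_sqrt hε.le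
  have hp : ‖w₁ - (ω : ℂ)‖ * ‖w₁ + (ω : ℂ)‖ ≤ ε := by
    rw [← norm_mul]
    have e : (w₁ - (ω : ℂ)) * (w₁ + (ω : ℂ)) = w₁ ^ 2 - (ω : ℂ) ^ 2 := by ring
    rwa [e]
  have hq : ‖w₁ + (ω : ℂ)‖ < Real.sqrt ε := by
    by_contra! hge
    nlinarith
  have ht : ‖w₁ - (ω : ℂ)‖ ≤ 2 * ‖w₁‖ + ‖w₁ + (ω : ℂ)‖ := by
    have e : w₁ - (ω : ℂ) = 2 * w₁ - (w₁ + (ω : ℂ)) := by ring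
    rw [e]
    refine (norm_sub_le _ _).trans ?_
    simp
  have key : w₁.re * ω < 0 := by
    by_contra! hge
    have : ‖w₁ - (ω : ℂ)‖ ≤ ‖w₁ + (ω : ℂ)‖ := by
      rw [← sq_le_sq₀ (norm_nonneg _) (norm_nonneg _), ← Complex.normSq_eq_norm_sq,
        ← Complex.normSq_eq_norm_sq, Complex.normSq_apply, Complex.normSq_apply]
      simp
      nlinarith
    linarith
  refine ⟨by linarith, ?_, ?_⟩
  · by_contra! hge
    nlinarith
  · rcases hω.eq_or_lt with h0 | h0
    · rw [← h0] at key
      simp at key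
    · exact h0
end

section
/- (Local Privalov theorem) Let μ ∈ (0,1). Suppose f = u + iv is a bounded holomorphic function on the open unit disk whose real part u has boundary values satisfying |u(e^{it}) - u(e^{is})| ≤ M|e^{it} - e^{is}|^μ for almost every s, t with |s - s₀| < δ, |t - s₀| < δ. Then there is a constant N depending on M, μ, δ, and sup|f| such that |f(z) - f(w)| ≤ N|z - w|^μ for all z, w in the region D_δ = {r e^{is} : 1/2 ≤ r < 1, |s - s₀| ≤ δ/2}. -/
open Complex Metric MeasureTheory

lemma pv_normSq (r₁ r₂ s t : ℝ) :
    ‖(r₁ : ℂ) * Complex.exp (I * s) - (r₂ : ℂ) * Complex.exp (I * t)‖ ^ 2 =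
      (r₁ - r₂) ^ 2 + 4 * r₁ * r₂ * Real.sin ((s - t) / 2) ^ 2 := by
  rw [← Complex.normSq_eq_norm_sq, Complex.normSq_apply, mul_comm I, mul_comm I]
  have h : Real.cos (s - t) = 1 - 2 * Real.sin ((s - t) / 2) ^ 2 := by
    have := Real.cos_two_mul ((s - t) / 2)
    have h2 := Real.sin_sq_add_cos_sq ((s - t) / 2)
    rw [mul_div_cancel₀ _ two_ne_zero] at this
    linarith
  rw [Real.cos_sub] at h
  simp only [sub_re, sub_im, re_ofReal_mul, im_ofReal_mul, exp_ofReal_mul_I_re,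
    exp_ofReal_mul_I_im]
  have a := Real.sin_sq_add_cos_sq s
  have b := Real.sin_sq_add_cos_sq t
  linear_combination r₁ ^ 2 * a + r₂ ^ 2 * b - 2 * r₁ * r₂ * h

lemma pv_lower (r₁ r₂ s t : ℝ) (h₁ : 0 ≤ r₁) (h₂ : 0 ≤ r₂) (hst : |s - t| ≤ Real.pi) :
    (r₁ - r₂) ^ 2 + r₁ * r₂ * (s - t) ^ 2 / 4 ≤
      ‖(r₁ : ℂ) * Complex.exp (I * s) - (r₂ : ℂ) * Complex.exp (I * t)‖ ^ 2 := by
  rw [pv_normSq]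
  have h := Real.mul_abs_le_abs_sin (x := (s - t) / 2) (by
    rw [abs_div, abs_two]; linarith)
  rw [abs_div, abs_two] at h
  have h' : |s - t| / 4 ≤ |Real.sin ((s - t) / 2)| := by
    refine le_trans ?_ h
    have : 1 / 2 ≤ 2 / Real.pi := by
      rw [div_le_div_iff₀ (by norm_num) Real.pi_pos]
      linarith [Real.pi_le_four]
    nlinarith [abs_nonneg (s - t)]
  have h3 : (s - t) ^ 2 / 16 ≤ Real.sin ((s - t) / 2) ^ 2 := by
    rw [← sq_abs (s - t), ← sq_abs (Real.sin _)]
    nlinarith [abs_nonneg (s - t)]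
  nlinarith [mul_nonneg h₁ h₂]

lemma pv_exp_norm (x : ℝ) : ‖Complex.exp (I * x)‖ = 1 := by
  rw [mul_comm]; exact norm_exp_ofReal_mul_I x

lemma pv_ne (r x : ℝ) (h0 : 0 ≤ r) (h1 : r < 1) : Complex.exp (I * x) - r ≠ 0 := by
  intro h
  have h2 := pv_exp_norm x
  rw [sub_eq_zero.1 h, Complex.norm_real, Real.norm_of_nonneg h0] at h2
  linarith

lemma pv_cont (r : ℝ) (h0 : 0 ≤ r) (h1 : r < 1) : Continuous (fun x : ℝ =>
    Complex.exp (I * x) / (Complex.exp (I * x) - r) ^ 2) := by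
  refine Continuous.div (by fun_prop) (by fun_prop) (fun x => pow_ne_zero 2 (pv_ne r x h0 h1))

lemma pv_herglotz {U : Set ℂ} (hU : IsOpen U) (hc : closedBall (0 : ℂ) 1 ⊆ U) (g : ℂ → ℂ)
    (hg : DifferentiableOn ℂ g U) (r : ℝ) (h0 : 0 ≤ r) (h1 : r < 1) :
    ∫ x in (-Real.pi)..Real.pi, Complex.exp (I * x) / (Complex.exp (I * x) - r) ^ 2 *
      ((g (Complex.exp (I * x))).re : ℂ) = Real.pi * deriv g r := by
  have hmem : ∀ x : ℝ, Complex.exp (I * x) ∈ U := fun x => hc (by simp)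
  have hgc : Continuous (fun x : ℝ => g (Complex.exp (I * x))) :=
    hg.continuousOn.comp_continuous (by fun_prop) hmem
  have hk := pv_cont r h0 h1
  have A : ∫ x in (0 : ℝ)..2 * Real.pi, Complex.exp (I * x) / (Complex.exp (I * x) - r) ^ 2 *
      g (Complex.exp (I * x)) = 2 * Real.pi * deriv g r := by
    have h := two_pi_I_inv_smul_circleIntegral_sub_sq_inv_smul_of_differentiable hU hc hg
      (w₀ := (r : ℂ)) (by simp [abs_of_nonneg h0, h1])
    rw [← h, circleIntegral]
    have : ∀ x : ℝ, deriv (circleMap 0 1) x • ((circleMap 0 1 x - (r : ℂ)) ^ 2)⁻¹ •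
        g (circleMap 0 1 x) = I * (Complex.exp (I * x) / (Complex.exp (I * x) - r) ^ 2 *
      g (Complex.exp (I * x))) := by
      intro x
      simp only [deriv_circleMap, circleMap, smul_eq_mul, ofReal_one, one_mul, zero_add]
      rw [mul_comm (x : ℂ) I]
      ring
    simp_rw [this]
    rw [intervalIntegral.integral_const_mul, smul_eq_mul]
    have : (Real.pi : ℂ) ≠ 0 := by exact_mod_cast Real.pi_ne_zero
    field_simp
  have B : ∫ x in (0 : ℝ)..2 * Real.pi, Complex.exp (I * x) / (Complex.exp (I * x) - r) ^ 2 *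
      (starRingEnd ℂ) (g (Complex.exp (I * x))) = 0 := by
    have hd : ∀ z ∈ closedBall (0 : ℂ) 1, (1 - r * z) ^ 2 ≠ 0 := by
      intro z hz
      apply pow_ne_zero
      intro h
      have h2 : ‖(r : ℂ) * z‖ = 1 := by rw [← sub_eq_zero.1 h, norm_one]
      rw [norm_mul, Complex.norm_real, Real.norm_of_nonneg h0] at h2
      have : ‖z‖ ≤ 1 := by simpa using hz
      nlinarith [norm_nonneg z]
    have h : ∮ z in C(0, 1), g z / (1 - r * z) ^ 2 = 0 := by
      apply circleIntegral_eq_zero_of_differentiable_on_off_countable zero_le_one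
        Set.countable_empty
      · refine ContinuousOn.div (hg.continuousOn.mono hc) (by fun_prop) hd
      · intro z hz
        have hz' : z ∈ closedBall (0 : ℂ) 1 := ball_subset_closedBall hz.1
        exact (hg.differentiableAt (hU.mem_nhds (hc hz'))).div (by fun_prop) (hd z hz')
    rw [circleIntegral] at h
    have : ∀ x : ℝ, deriv (circleMap 0 1) x • (g (circleMap 0 1 x) /
        (1 - r * circleMap 0 1 x) ^ 2) = I * (starRingEnd ℂ) (Complex.exp (I * x) /
        (Complex.exp (I * x) - r) ^ 2 * (starRingEnd ℂ) (g (Complex.exp (I * x)))) := by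
      intro x
      simp only [deriv_circleMap, circleMap, smul_eq_mul, ofReal_one, one_mul, zero_add]
      rw [mul_comm (x : ℂ) I]
      have e : (starRingEnd ℂ) (Complex.exp (I * x)) = (Complex.exp (I * x))⁻¹ := by
        rw [← Complex.exp_conj, ← Complex.exp_neg]; simp
      have hne := Complex.exp_ne_zero (I * x)
      have hm := hd (Complex.exp (I * x)) (by simp)
      have hm' : (1 : ℂ) - r * Complex.exp (I * x) ≠ 0 := fun h => hm (by rw [h]; simp)
      simp only [map_mul, map_div₀, map_pow, map_sub, e, conj_conj, conj_ofReal]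
      have : (Complex.exp (I * x))⁻¹ - r = (1 - r * Complex.exp (I * x)) / Complex.exp (I * x) := by
        field_simp
      rw [this]
      field_simp
    simp_rw [this] at h
    rw [intervalIntegral.integral_const_mul] at h
    have h := (mul_eq_zero.1 h).resolve_left I_ne_zero
    rw [intervalIntegral.integral_of_le Real.two_pi_pos.le, integral_conj] at h
    rw [intervalIntegral.integral_of_le Real.two_pi_pos.le]
    simpa using h
  have P : Function.Periodic (fun x : ℝ => Complex.exp (I * x) / (Complex.exp (I * x) - r) ^ 2 *
      ((g (Complex.exp (I * x))).re : ℂ)) (2 * Real.pi) := by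
    intro x
    have : Complex.exp (I * (x + 2 * Real.pi : ℝ)) = Complex.exp (I * x) := by
      rw [show I * ((x + 2 * Real.pi : ℝ) : ℂ) = I * x + 2 * Real.pi * I by push_cast; ring,
        Complex.exp_add, Complex.exp_two_pi_mul_I, mul_one]
    simp only [this]
  have Q := P.intervalIntegral_add_eq (-Real.pi) 0
  rw [show -Real.pi + 2 * Real.pi = Real.pi by ring, zero_add] at Q
  rw [Q]
  have : ∀ x : ℝ, Complex.exp (I * x) / (Complex.exp (I * x) - r) ^ 2 *
      ((g (Complex.exp (I * x))).re : ℂ) = (1 / 2) * (Complex.exp (I * x) /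
        (Complex.exp (I * x) - r) ^ 2 * g (Complex.exp (I * x)) + Complex.exp (I * x) /
        (Complex.exp (I * x) - r) ^ 2 * (starRingEnd ℂ) (g (Complex.exp (I * x)))) := by
    intro x
    rw [Complex.re_eq_add_conj]; ring
  simp_rw [this]
  rw [intervalIntegral.integral_const_mul, intervalIntegral.integral_add, A, B]
  · ring
  · exact (hk.mul hgc).intervalIntegrable _ _
  · exact (hk.mul (continuous_conj.comp hgc)).intervalIntegrable _ _

lemma pv_kernel (μ : ℝ) (hμ : μ ∈ Set.Ioo (0 : ℝ) 1) : ∃ A : ℝ, 0 ≤ A ∧ ∀ h : ℝ, 0 < h →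
    Integrable (fun x : ℝ => (h ^ 2 + x ^ 2) ^ (μ / 2 - 1)) ∧
    ∫ x : ℝ, (h ^ 2 + x ^ 2) ^ (μ / 2 - 1) = A * h ^ (μ - 1) := by
  refine ⟨∫ x : ℝ, (1 + x ^ 2) ^ (μ / 2 - 1), integral_nonneg fun x => by positivity, ?_⟩
  intro h hh
  have key : ∀ x : ℝ, (h ^ 2 + x ^ 2) ^ (μ / 2 - 1) =
      h ^ (μ - 2) * (1 + (x / h) ^ 2) ^ (μ / 2 - 1) := by
    intro x
    have : h ^ 2 + x ^ 2 = h ^ 2 * (1 + (x / h) ^ 2) := by field_simp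
    rw [this, Real.mul_rpow (by positivity) (by positivity), ← Real.rpow_natCast,
      ← Real.rpow_mul hh.le]
    congr 2
    push_cast; ring
  simp_rw [key]
  constructor
  · apply Integrable.const_mul
    have := integrable_rpow_neg_one_add_norm_sq (E := ℝ) (μ := volume) (r := 2 - μ)
      (by simp; linarith [hμ.2])
    have h2 := this.comp_div hh.ne'
    refine h2.congr (Filter.Eventually.of_forall fun x => ?_)
    simp only [Real.norm_eq_abs, sq_abs]
    congr 1; ring
  · rw [integral_const_mul,
      Measure.integral_comp_div (fun y : ℝ => (1 + y ^ 2) ^ (μ / 2 - 1)) h, abs_of_pos hh,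
      smul_eq_mul, show μ - 1 = (μ - 2) + 1 by ring, Real.rpow_add hh, Real.rpow_one]
    ring

lemma pv_deriv (μ A C L : ℝ) (hμ : μ ∈ Set.Ioo (0 : ℝ) 1) (hL : 0 ≤ L) (hA0 : 0 ≤ A)
    (hA : ∀ h : ℝ, 0 < h →
      Integrable (fun x : ℝ => (h ^ 2 + x ^ 2) ^ (μ / 2 - 1)) ∧
      ∫ x : ℝ, (h ^ 2 + x ^ 2) ^ (μ / 2 - 1) = A * h ^ (μ - 1))
    (f : ℂ → ℂ) (u : ℝ → ℝ) (hf : DifferentiableOn ℂ f (ball (0 : ℂ) 1))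
    (hC : ∀ z ∈ ball (0 : ℂ) 1, ‖f z‖ ≤ C)
    (hu : ∀ᵐ s : ℝ, Filter.Tendsto (fun r : ℝ => (f ((r : ℂ) * Complex.exp (I * s))).re)
        (nhdsWithin 1 (Set.Iio 1)) (nhds (u s)))
    (s : ℝ) (hs : ∀ᵐ t : ℝ, |t - s| ≤ Real.pi → |u t - u s| ≤ L * |t - s| ^ μ)
    (r : ℝ) (hr : 1 / 2 ≤ r) (hr1 : r < 1) :
    ‖deriv f ((r : ℂ) * Complex.exp (I * s))‖ ≤ 8 * L * A * (1 - r) ^ (μ - 1) := by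
  have h0 : 0 ≤ r := by linarith
  set k : ℝ → ℂ := fun x => Complex.exp (I * x) / (Complex.exp (I * x) - r) ^ 2 with hk
  have hkc : Continuous k := pv_cont r h0 hr1
  have hmem : ∀ ρ : ℝ, ρ ∈ Set.Ioo (0 : ℝ) 1 → ∀ x : ℝ,
      (ρ : ℂ) * Complex.exp (I * x) ∈ ball (0 : ℂ) 1 := by
    intro ρ hρ x
    simp [abs_of_pos hρ.1, hρ.2]
  have hev : ∀ᶠ ρ : ℝ in nhdsWithin 1 (Set.Iio 1), ρ ∈ Set.Ioo (0 : ℝ) 1 :=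
    Ioo_mem_nhdsLT (by norm_num)
  have hexp : ∀ x : ℝ, Complex.exp (I * s) * Complex.exp (I * x) =
      Complex.exp (I * (s + x : ℝ)) := by
    intro x; rw [← Complex.exp_add]; congr 1; push_cast; ring
  have E : ∀ ρ : ℝ, ρ ∈ Set.Ioo (0 : ℝ) 1 →
      ∫ x in (-Real.pi)..Real.pi, k x *
        (((f ((ρ : ℂ) * Complex.exp (I * (s + x : ℝ)))).re - u s : ℝ) : ℂ) =
      Real.pi * (ρ * Complex.exp (I * s) *
        deriv f (ρ * Complex.exp (I * s) * r)) := by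
    intro ρ hρ
    set c : ℂ := ρ * Complex.exp (I * s) with hcdef
    have hcn : ‖c‖ = ρ := by simp [hcdef, abs_of_pos hρ.1]
    have hmap : ∀ z ∈ ball (0 : ℂ) (1 / ρ), c * z ∈ ball (0 : ℂ) 1 := by
      intro z hz
      have hz : ‖z‖ < 1 / ρ := by simpa using hz
      rw [lt_div_iff₀ hρ.1] at hz
      simp only [mem_ball_zero_iff, norm_mul, hcn]
      linarith
    have hrU : (r : ℂ) ∈ ball (0 : ℂ) (1 / ρ) := by
      simp only [mem_ball_zero_iff, Complex.norm_real, Real.norm_of_nonneg h0]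
      rw [lt_div_iff₀ hρ.1]; nlinarith [hρ.1, hρ.2]
    have H := pv_herglotz (U := ball 0 (1 / ρ)) isOpen_ball
      (closedBall_subset_ball (by rw [lt_div_iff₀ hρ.1]; linarith [hρ.2]))
      (fun z => f (c * z) - (u s : ℂ))
      ((hf.comp (by fun_prop) hmap).sub_const _) r h0 hr1
    have hder : deriv (fun z => f (c * z) - (u s : ℂ)) r = c * deriv f (c * r) := by
      rw [deriv_sub_const, deriv_comp_mul_left, smul_eq_mul]
    rw [hder] at H
    rw [← H]
    apply intervalIntegral.integral_congr
    intro x _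
    simp only [hk, hcdef, mul_assoc, hexp, sub_re, ofReal_re]
  have T1 : Filter.Tendsto (fun ρ : ℝ => (Real.pi : ℂ) * (ρ * Complex.exp (I * s) *
        deriv f (ρ * Complex.exp (I * s) * r))) (nhdsWithin 1 (Set.Iio 1))
      (nhds (Real.pi * (Complex.exp (I * s) * deriv f (r * Complex.exp (I * s))))) := by
    have hz : (r : ℂ) * Complex.exp (I * s) ∈ ball (0 : ℂ) 1 := hmem r ⟨by linarith, hr1⟩ s
    have hd : ContinuousAt (deriv f) (((1 : ℝ) : ℂ) * Complex.exp (I * s) * r) := by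
      have := ((hf.deriv isOpen_ball).continuousOn).continuousAt (isOpen_ball.mem_nhds hz)
      rwa [ofReal_one, one_mul, mul_comm]
    have hcm : ContinuousAt (fun ρ : ℝ => (Real.pi : ℂ) * (ρ * Complex.exp (I * s) *
        deriv f (ρ * Complex.exp (I * s) * r))) 1 := by
      have : ContinuousAt (fun ρ : ℝ => deriv f (ρ * Complex.exp (I * s) * r)) 1 :=
        ContinuousAt.comp (f := fun ρ : ℝ => (ρ : ℂ) * Complex.exp (I * s) * r) hd
          (by fun_prop)
      fun_prop
    have := hcm.tendsto.mono_left (nhdsWithin_le_nhds (s := Set.Iio 1))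
    convert this using 2
    simp [mul_comm]
  have hu' : ∀ᵐ x : ℝ, Filter.Tendsto
      (fun ρ : ℝ => (f ((ρ : ℂ) * Complex.exp (I * (s + x : ℝ)))).re)
      (nhdsWithin 1 (Set.Iio 1)) (nhds (u (s + x))) :=
    (measurePreserving_add_left volume s).quasiMeasurePreserving.ae hu
  have hs' : ∀ᵐ x : ℝ, |x| ≤ Real.pi → |u (s + x) - u s| ≤ L * |x| ^ μ := by
    have := (measurePreserving_add_left volume s).quasiMeasurePreserving.ae hs
    simpa using this
  have T2 : Filter.Tendsto (fun ρ : ℝ => ∫ x in (-Real.pi)..Real.pi, k x *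
        (((f ((ρ : ℂ) * Complex.exp (I * (s + x : ℝ)))).re - u s : ℝ) : ℂ))
      (nhdsWithin 1 (Set.Iio 1)) (nhds (∫ x in (-Real.pi)..Real.pi, k x *
        ((u (s + x) - u s : ℝ) : ℂ))) := by
    apply intervalIntegral.tendsto_integral_filter_of_dominated_convergence
      (fun x => ‖k x‖ * (C + |u s|))
    · filter_upwards [hev] with ρ hρ
      have h1 : Continuous (fun x : ℝ => f ((ρ : ℂ) * Complex.exp (I * (s + x : ℝ)))) :=
        hf.continuousOn.comp_continuous (by fun_prop) (fun x => hmem ρ hρ _)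
      exact (hkc.mul (continuous_ofReal.comp
        ((continuous_re.comp h1).sub continuous_const))).aestronglyMeasurable
    · filter_upwards [hev] with ρ hρ
      refine Filter.Eventually.of_forall fun x _ => ?_
      rw [norm_mul, Complex.norm_real, Real.norm_eq_abs]
      refine mul_le_mul_of_nonneg_left ?_ (norm_nonneg _)
      refine (abs_sub _ _).trans (add_le_add ?_ le_rfl)
      exact (Complex.abs_re_le_norm _).trans (hC _ (hmem ρ hρ _))
    · exact Continuous.intervalIntegrable (by fun_prop) _ _
    · filter_upwards [hu'] with x hx _
      exact ((continuous_ofReal.tendsto _).comp (hx.sub_const _)).const_mul _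
  have T2' := T2.congr' (hev.mono fun ρ hρ => E ρ hρ)
  have EQ := tendsto_nhds_unique T1 T2'
  have hh : 0 < 1 - r := by linarith
  obtain ⟨hi, hI⟩ := hA (1 - r) hh
  have hbd : ‖∫ x in (-Real.pi)..Real.pi, k x * ((u (s + x) - u s : ℝ) : ℂ)‖ ≤
      ∫ x in (-Real.pi)..Real.pi, 8 * L * ((1 - r) ^ 2 + x ^ 2) ^ (μ / 2 - 1) := by
    apply intervalIntegral.norm_integral_le_of_norm_le (by linarith [Real.pi_pos])
    · filter_upwards [hs'] with x hx hxm
      have hxa : |x| ≤ Real.pi := abs_le.2 ⟨hxm.1.le, hxm.2⟩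
      have hD := pv_lower 1 r x 0 zero_le_one h0 (by simpa using hxa)
      simp only [ofReal_one, one_mul, ofReal_zero, mul_zero, Complex.exp_zero, mul_one,
        sub_zero] at hD
      set D := ‖Complex.exp (I * x) - r‖ with hDdef
      set q := (1 - r) ^ 2 + x ^ 2 with hq
      have hqpos : 0 < q := by positivity
      have hD2 : q / 8 ≤ D ^ 2 := by nlinarith [sq_nonneg x, sq_nonneg (1 - r)]
      have hkn : ‖k x‖ ≤ 8 / q := by
        simp only [hk, norm_div, norm_pow, pv_exp_norm]
        rw [div_le_div_iff₀ (by linarith) hqpos]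
        linarith
      have hxq : |x| ^ μ ≤ q ^ (μ / 2) := by
        rw [show μ = 2 * (μ / 2) by ring, Real.rpow_mul (abs_nonneg x),
          show 2 * (μ / 2) / 2 = μ / 2 by ring]
        apply Real.rpow_le_rpow (by positivity) _ (by linarith [hμ.1])
        rw [Real.rpow_two, sq_abs]
        nlinarith [sq_nonneg (1 - r)]
      rw [norm_mul, Complex.norm_real, Real.norm_eq_abs]
      calc ‖k x‖ * |u (s + x) - u s| ≤ 8 / q * (L * q ^ (μ / 2)) := by
            apply mul_le_mul hkn _ (abs_nonneg _) (by positivity)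
            exact (hx hxa).trans (mul_le_mul_of_nonneg_left hxq hL)
        _ = 8 * L * q ^ (μ / 2 - 1) := by
            rw [Real.rpow_sub hqpos, Real.rpow_one]; ring
    · exact (hi.const_mul _).intervalIntegrable
  rw [← EQ, norm_mul, norm_mul, pv_exp_norm, one_mul, Complex.norm_real,
    Real.norm_of_nonneg Real.pi_pos.le] at hbd
  have hle : ∫ x in (-Real.pi)..Real.pi, 8 * L * ((1 - r) ^ 2 + x ^ 2) ^ (μ / 2 - 1) ≤
      8 * L * (A * (1 - r) ^ (μ - 1)) := by
    rw [← hI, ← integral_const_mul, intervalIntegral.integral_of_le (by linarith [Real.pi_pos])]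
    apply setIntegral_le_integral (hi.const_mul _)
    exact Filter.Eventually.of_forall fun x => by positivity
  have := Real.pi_gt_three
  nlinarith [norm_nonneg (deriv f ((r : ℂ) * Complex.exp (I * s)))]

lemma pv_hasDeriv (f : ℂ → ℂ) (hf : DifferentiableOn ℂ f (ball (0 : ℂ) 1)) (r s : ℝ)
    (h0 : 0 ≤ r) (h1 : r < 1) :
    HasDerivAt f (deriv f ((r : ℂ) * Complex.exp (I * s))) ((r : ℂ) * Complex.exp (I * s)) :=
  (hf.differentiableAt (isOpen_ball.mem_nhds (by simp [abs_of_nonneg h0, h1]))).hasDerivAt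

lemma pv_radial (μ K : ℝ) (hμ : μ ∈ Set.Ioo (0 : ℝ) 1) (hK : 0 ≤ K)
    (f : ℂ → ℂ) (hf : DifferentiableOn ℂ f (ball (0 : ℂ) 1)) (s : ℝ)
    (hd : ∀ r : ℝ, 1 / 2 ≤ r → r < 1 →
      ‖deriv f ((r : ℂ) * Complex.exp (I * s))‖ ≤ K * (1 - r) ^ (μ - 1))
    (ρ r : ℝ) (hρ : 1 / 2 ≤ ρ) (hρr : ρ ≤ r) (hr : r < 1) :
    ‖f ((r : ℂ) * Complex.exp (I * s)) - f ((ρ : ℂ) * Complex.exp (I * s))‖ ≤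
      K / μ * (r - ρ) ^ μ := by
  have hD : ∀ x ∈ Set.Icc ρ r, HasDerivAt (fun x : ℝ => f ((x : ℂ) * Complex.exp (I * s)) -
      f ((ρ : ℂ) * Complex.exp (I * s)))
      (deriv f ((x : ℂ) * Complex.exp (I * s)) * Complex.exp (I * s)) x := by
    intro x hx
    have h1 := pv_hasDeriv f hf x s (by linarith [hx.1]) (by linarith [hx.2])
    have h2 : HasDerivAt (fun x : ℝ => (x : ℂ) * Complex.exp (I * s)) (Complex.exp (I * s)) x := by
      simpa using (Complex.ofRealCLM.hasDerivAt (x := x)).mul_const (Complex.exp (I * s))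
    exact (h1.comp x h2).sub_const _
  have hB : ∀ x ∈ Set.Icc ρ r, HasDerivAt (fun x : ℝ => K / μ * ((1 - ρ) ^ μ - (1 - x) ^ μ))
      (K * (1 - x) ^ (μ - 1)) x := by
    intro x hx
    have h1 : HasDerivAt (fun x : ℝ => 1 - x) (-1) x := by
      simpa using (hasDerivAt_id x).const_sub 1
    have h2 := ((h1.rpow_const (p := μ) (Or.inl (by linarith [hx.2]))).const_sub
      ((1 - ρ) ^ μ)).const_mul (K / μ)
    have h5 : K * (1 - x) ^ (μ - 1) = K / μ * -(-1 * μ * (1 - x) ^ (μ - 1)) := by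
      have h6 := hμ.1.ne'
      field_simp
    rw [h5]
    exact h2
  have := image_norm_le_of_norm_deriv_right_le_deriv_boundary'
    (fun x hx => (hD x hx).continuousAt.continuousWithinAt)
    (fun x hx => (hD x ⟨hx.1, hx.2.le⟩).hasDerivWithinAt)
    (by simp) (fun x hx => (hB x hx).continuousAt.continuousWithinAt)
    (fun x hx => (hB x ⟨hx.1, hx.2.le⟩).hasDerivWithinAt)
    (fun x hx => by
      rw [norm_mul, pv_exp_norm, mul_one]
      exact hd x (hρ.trans hx.1) (hx.2.trans hr)) (Set.right_mem_Icc.2 hρr)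
  refine this.trans (mul_le_mul_of_nonneg_left ?_ (div_nonneg hK hμ.1.le))
  have h3 := Real.rpow_add_le_add_rpow (p := μ) (a := r - ρ) (b := 1 - r) (by linarith)
    (by linarith) hμ.1.le hμ.2.le
  rw [show r - ρ + (1 - r) = 1 - ρ by ring] at h3
  linarith

lemma pv_angular (K' : ℝ) (S : Set ℝ) (hS : Convex ℝ S)
    (f : ℂ → ℂ) (hf : DifferentiableOn ℂ f (ball (0 : ℂ) 1)) (r : ℝ) (hr0 : 0 ≤ r) (hr : r < 1)
    (hd : ∀ s ∈ S, ‖deriv f ((r : ℂ) * Complex.exp (I * s))‖ ≤ K')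
    (s t : ℝ) (hs : s ∈ S) (ht : t ∈ S) :
    ‖f ((r : ℂ) * Complex.exp (I * s)) - f ((r : ℂ) * Complex.exp (I * t))‖ ≤
      K' * |s - t| := by
  refine Convex.norm_image_sub_le_of_norm_hasDerivWithin_le
    (f := fun s : ℝ => f ((r : ℂ) * Complex.exp (I * s)))
    (f' := fun s : ℝ => deriv f ((r : ℂ) * Complex.exp (I * s)) *
      ((r : ℂ) * (Complex.exp (I * s) * I))) (s := S) ?_ ?_ hS ht hs
  · intro x _
    have h1 := pv_hasDeriv f hf r x hr0 hr
    have h2 : HasDerivAt (fun x : ℝ => (r : ℂ) * Complex.exp (I * x))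
        ((r : ℂ) * (Complex.exp (I * x) * I)) x := by
      have h3 : HasDerivAt (fun x : ℝ => I * (x : ℂ)) I x := by
        simpa using (Complex.ofRealCLM.hasDerivAt (x := x)).const_mul I
      exact h3.cexp.const_mul _
    exact (h1.comp x h2).hasDerivWithinAt
  · intro x hx
    simp only [norm_mul, pv_exp_norm, norm_I, Complex.norm_real, Real.norm_of_nonneg hr0]
    have := hd x hx
    nlinarith [norm_nonneg (deriv f ((r : ℂ) * Complex.exp (I * x)))]

lemma pv_hl (μ K : ℝ) (hμ : μ ∈ Set.Ioo (0 : ℝ) 1) (hK : 0 ≤ K) (S : Set ℝ) (hS : Convex ℝ S)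
    (f : ℂ → ℂ) (hf : DifferentiableOn ℂ f (ball (0 : ℂ) 1))
    (hd : ∀ s ∈ S, ∀ r : ℝ, 1 / 2 ≤ r → r < 1 →
      ‖deriv f ((r : ℂ) * Complex.exp (I * s))‖ ≤ K * (1 - r) ^ (μ - 1))
    (r₁ r₂ s₁ s₂ : ℝ) (h1 : 1 / 2 ≤ r₁) (h1' : r₁ < 1) (h2 : 1 / 2 ≤ r₂) (h2' : r₂ < 1)
    (hs₁ : s₁ ∈ S) (hs₂ : s₂ ∈ S) (hs : |s₁ - s₂| ≤ Real.pi) (d : ℝ)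
    (hdd : d = ‖(r₁ : ℂ) * Complex.exp (I * s₁) - (r₂ : ℂ) * Complex.exp (I * s₂)‖)
    (hd0 : 0 < d) (hd1 : d < 1 / 2) :
    ‖f ((r₁ : ℂ) * Complex.exp (I * s₁)) - f ((r₂ : ℂ) * Complex.exp (I * s₂))‖ ≤
      (2 * K / μ + 4 * K) * d ^ μ := by
  have hlow := pv_lower r₁ r₂ s₁ s₂ (by linarith) (by linarith) hs
  rw [← hdd] at hlow
  have hrr : 1 / 4 ≤ r₁ * r₂ := by nlinarith
  have hang : |s₁ - s₂| ≤ 4 * d := by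
    apply abs_le_of_sq_le_sq _ (by linarith)
    nlinarith [sq_nonneg (s₁ - s₂), sq_nonneg (r₁ - r₂)]
  have hrad : |r₁ - r₂| ≤ d := by
    apply abs_le_of_sq_le_sq _ hd0.le
    have : 0 ≤ r₁ * r₂ * (s₁ - s₂) ^ 2 / 4 := by positivity
    linarith
  rw [abs_le] at hrad
  obtain ⟨ρ, hρ, hρ1, hρ2, hρd, hρa, hρb⟩ : ∃ ρ : ℝ, 1 / 2 ≤ ρ ∧ ρ ≤ r₁ ∧ ρ ≤ r₂ ∧
      d ≤ 1 - ρ ∧ r₁ - ρ ≤ d ∧ r₂ - ρ ≤ d := by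
    refine ⟨min (min r₁ r₂) (1 - d), ?_, ?_, ?_, ?_, ?_, ?_⟩
    · exact le_min (le_min h1 h2) (by linarith)
    · exact (min_le_left _ _).trans (min_le_left _ _)
    · exact (min_le_left _ _).trans (min_le_right _ _)
    · linarith [min_le_right (min r₁ r₂) (1 - d)]
    · have : r₁ - d ≤ min (min r₁ r₂) (1 - d) :=
        le_min (le_min (by linarith) (by linarith)) (by linarith)
      linarith
    · have : r₂ - d ≤ min (min r₁ r₂) (1 - d) :=
        le_min (le_min (by linarith) (by linarith)) (by linarith)
      linarith
  have A := pv_radial μ K hμ hK f hf s₁ (hd s₁ hs₁) ρ r₁ hρ hρ1 h1'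
  have B := pv_radial μ K hμ hK f hf s₂ (hd s₂ hs₂) ρ r₂ hρ hρ2 h2'
  have D := pv_angular (K * (1 - ρ) ^ (μ - 1)) S hS f hf ρ (by linarith) (by linarith)
    (fun s hs => hd s hs ρ hρ (by linarith)) s₁ s₂ hs₁ hs₂
  have hKμ : 0 ≤ K / μ := div_nonneg hK hμ.1.le
  have A' : K / μ * (r₁ - ρ) ^ μ ≤ K / μ * d ^ μ := mul_le_mul_of_nonneg_left
    (Real.rpow_le_rpow (by linarith) hρa hμ.1.le) hKμ
  have B' : K / μ * (r₂ - ρ) ^ μ ≤ K / μ * d ^ μ := mul_le_mul_of_nonneg_left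
    (Real.rpow_le_rpow (by linarith) hρb hμ.1.le) hKμ
  have D' : K * (1 - ρ) ^ (μ - 1) * |s₁ - s₂| ≤ 4 * K * d ^ μ := by
    have e : (1 - ρ) ^ (μ - 1) ≤ d ^ (μ - 1) :=
      Real.rpow_le_rpow_of_nonpos hd0 hρd (by linarith [hμ.2])
    calc K * (1 - ρ) ^ (μ - 1) * |s₁ - s₂| ≤ K * d ^ (μ - 1) * (4 * d) := by gcongr
      _ = 4 * K * d ^ μ := by
        rw [Real.rpow_sub hd0, Real.rpow_one]; field_simp
  rw [norm_sub_rev] at B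
  calc _ = ‖(f ((r₁ : ℂ) * Complex.exp (I * s₁)) - f ((ρ : ℂ) * Complex.exp (I * s₁))) +
        (f ((ρ : ℂ) * Complex.exp (I * s₁)) - f ((ρ : ℂ) * Complex.exp (I * s₂))) +
        (f ((ρ : ℂ) * Complex.exp (I * s₂)) - f ((r₂ : ℂ) * Complex.exp (I * s₂)))‖ := by
        congr 1; ring
    _ ≤ K / μ * d ^ μ + 4 * K * d ^ μ + K / μ * d ^ μ :=
        (norm_add₃_le).trans (add_le_add (add_le_add (A.trans A') (D.trans D')) (B.trans B'))
    _ = _ := by ring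

lemma pv_exp_shift (s : ℝ) (n : ℤ) :
    Complex.exp (I * ((s + n * (2 * Real.pi) : ℝ) : ℂ)) = Complex.exp (I * s) := by
  rw [show I * ((s + n * (2 * Real.pi) : ℝ) : ℂ) = I * s + n * (2 * Real.pi * I) by
    push_cast; ring]
  exact Complex.exp_periodic.int_mul n _

lemma pv_shift (s a : ℝ) : ∃ n : ℤ, |s + n * (2 * Real.pi) - a| ≤ Real.pi := by
  obtain ⟨n, hn, -⟩ := existsUnique_add_zsmul_mem_Ico Real.two_pi_pos s (a - Real.pi)
  refine ⟨n, ?_⟩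
  simp only [zsmul_eq_mul] at hn
  rw [abs_le]
  constructor <;> linarith [hn.1, hn.2]

lemma pv_chord (s t : ℝ) : ‖Complex.exp (I * s) - Complex.exp (I * t)‖ ≤ |s - t| := by
  have h := pv_normSq 1 1 s t
  simp only [ofReal_one, one_mul] at h
  rw [← abs_of_nonneg (norm_nonneg (Complex.exp (I * s) - Complex.exp (I * t))), ← sq_le_sq, h]
  have h2 : Real.sin ((s - t) / 2) ^ 2 ≤ ((s - t) / 2) ^ 2 := by
    rw [sq_le_sq]; exact Real.abs_sin_le_abs
  nlinarith

lemma pv_deriv_arc (M μ δ C s₀ A : ℝ) (hμ : μ ∈ Set.Ioo (0 : ℝ) 1) (hδ : 0 < δ)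
    (hM : 0 < M) (hC : 0 < C) (hA0 : 0 ≤ A)
    (hA : ∀ h : ℝ, 0 < h →
      Integrable (fun x : ℝ => (h ^ 2 + x ^ 2) ^ (μ / 2 - 1)) ∧
      ∫ x : ℝ, (h ^ 2 + x ^ 2) ^ (μ / 2 - 1) = A * h ^ (μ - 1))
    (f : ℂ → ℂ) (u : ℝ → ℝ) (hf : DifferentiableOn ℂ f (ball (0 : ℂ) 1))
    (hfC : ∀ z ∈ ball (0 : ℂ) 1, ‖f z‖ ≤ C)
    (hu : ∀ᵐ s : ℝ, Filter.Tendsto (fun r : ℝ => (f ((r : ℂ) * Complex.exp (I * s))).re)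
        (nhdsWithin 1 (Set.Iio 1)) (nhds (u s)))
    (hH : ∀ᵐ p : ℝ × ℝ, |p.1 - s₀| < δ → |p.2 - s₀| < δ →
        |u p.1 - u p.2| ≤ M * ‖Complex.exp (I * p.1) - Complex.exp (I * p.2)‖ ^ μ)
    (s : ℝ) (hs : |s - s₀| ≤ δ / 2) (r : ℝ) (hr : 1 / 2 ≤ r) (hr1 : r < 1) :
    ‖deriv f ((r : ℂ) * Complex.exp (I * s))‖ ≤
      8 * (M + 2 * C * (2 / δ) ^ μ) * A * (1 - r) ^ (μ - 1) := by
  have huC : ∀ᵐ s : ℝ, |u s| ≤ C := by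
    filter_upwards [hu] with s hs
    apply le_of_tendsto hs.abs
    filter_upwards [Ioo_mem_nhdsLT (show (0 : ℝ) < 1 by norm_num)] with ρ hρ
    exact (Complex.abs_re_le_norm _).trans (hfC _ (by simp [abs_of_pos hρ.1, hρ.2]))
  have hae : ∀ᵐ s : ℝ, |s - s₀| < δ / 2 → ‖deriv f ((r : ℂ) * Complex.exp (I * s))‖ ≤
      8 * (M + 2 * C * (2 / δ) ^ μ) * A * (1 - r) ^ (μ - 1) := by
    have hH' := Measure.ae_ae_of_ae_prod (μ := (volume : Measure ℝ)) (ν := volume) hH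
    filter_upwards [hH', huC] with s hs hsC hss
    apply pv_deriv μ A C _ hμ (by positivity) hA0 hA f u hf hfC hu s _ r hr hr1
    filter_upwards [hs, huC] with t ht htC _
    rw [add_mul]
    have p1 : 0 ≤ M * |t - s| ^ μ := by positivity
    have p2 : 0 ≤ 2 * C * (2 / δ) ^ μ * |t - s| ^ μ := by positivity
    by_cases hts : |t - s| < δ / 2
    · have h3 : |t - s₀| < δ := by
        have := abs_sub_le t s s₀
        linarith
      have h4 := ht (by linarith) h3
      rw [abs_sub_comm] at h4
      have h5 : ‖Complex.exp (I * s) - Complex.exp (I * t)‖ ^ μ ≤ |t - s| ^ μ := by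
        apply Real.rpow_le_rpow (norm_nonneg _) _ hμ.1.le
        rw [abs_sub_comm]; exact pv_chord s t
      have := mul_le_mul_of_nonneg_left h5 hM.le
      linarith
    · push Not at hts
      have h5 : 1 ≤ (2 / δ) ^ μ * |t - s| ^ μ := by
        rw [← Real.mul_rpow (by positivity) (abs_nonneg _)]
        apply Real.one_le_rpow _ hμ.1.le
        rw [div_mul_eq_mul_div, le_div_iff₀ hδ]; linarith
      have h6 : |u t - u s| ≤ 2 * C := by
        have := abs_sub (u t) (u s); linarith
      nlinarith
  have hcl : IsClosed {s : ℝ | ‖deriv f ((r : ℂ) * Complex.exp (I * s))‖ ≤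
      8 * (M + 2 * C * (2 / δ) ^ μ) * A * (1 - r) ^ (μ - 1)} := by
    apply isClosed_le _ continuous_const
    apply Continuous.norm
    exact (hf.deriv isOpen_ball).continuousOn.comp_continuous (by fun_prop)
      (fun x => by simp [abs_of_nonneg (show 0 ≤ r by linarith), hr1])
  have hdense := (Measure.dense_of_ae hae).open_subset_closure_inter
    (isOpen_ball (x := s₀) (ε := δ / 2))
  have hsub : ball s₀ (δ / 2) ⊆ {s : ℝ | ‖deriv f ((r : ℂ) * Complex.exp (I * s))‖ ≤
      8 * (M + 2 * C * (2 / δ) ^ μ) * A * (1 - r) ^ (μ - 1)} := by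
    refine hdense.trans (closure_minimal ?_ hcl)
    rintro x ⟨hx, hx'⟩
    exact hx' (by simpa [Real.dist_eq] using hx)
  have := closure_minimal hsub hcl
  rw [closure_ball _ (by positivity)] at this
  exact this (by simpa [Real.dist_eq] using hs)

/-- Local Privalov theorem: if `f` is bounded holomorphic on the unit disk and the
boundary values of `u = Re f` satisfy a Hölder condition on the arc
`{e^{is} : |s - s₀| < δ}`, then `f` is `μ`-Hölder on
`D_δ = {r e^{is} : 1/2 ≤ r < 1, |s - s₀| ≤ δ/2}`, with constant depending only on
`M`, `μ`, `δ` and the sup of `|f|`. -/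
theorem stmt_7 (M μ δ C s₀ : ℝ) (hμ : μ ∈ Set.Ioo (0 : ℝ) 1) (hδ : 0 < δ)
    (hM : 0 < M) (hC : 0 < C) :
    ∃ N : ℝ, ∀ f : ℂ → ℂ, ∀ u : ℝ → ℝ,
      DifferentiableOn ℂ f (ball (0 : ℂ) 1) →
      (∀ z ∈ ball (0 : ℂ) 1, ‖f z‖ ≤ C) →
      (∀ᵐ s : ℝ, Filter.Tendsto (fun r : ℝ => (f ((r : ℂ) * Complex.exp (I * s))).re)
        (nhdsWithin 1 (Set.Iio 1)) (nhds (u s))) →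
      (∀ᵐ p : ℝ × ℝ, |p.1 - s₀| < δ → |p.2 - s₀| < δ →
        |u p.1 - u p.2| ≤ M * ‖Complex.exp (I * p.1) - Complex.exp (I * p.2)‖ ^ μ) →
      ∀ z w : ℂ,
        z ∈ {ζ : ℂ | ∃ r s : ℝ, 1 / 2 ≤ r ∧ r < 1 ∧ |s - s₀| ≤ δ / 2 ∧
              ζ = (r : ℂ) * Complex.exp (I * s)} →
        w ∈ {ζ : ℂ | ∃ r s : ℝ, 1 / 2 ≤ r ∧ r < 1 ∧ |s - s₀| ≤ δ / 2 ∧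
              ζ = (r : ℂ) * Complex.exp (I * s)} →
        ‖f z - f w‖ ≤ N * ‖z - w‖ ^ μ := by
  obtain ⟨A, hA0, hA⟩ := pv_kernel μ hμ
  set K := 8 * (M + 2 * C * (2 / δ) ^ μ) * A with hKdef
  have hK : 0 ≤ K := by positivity
  have hμ0 := hμ.1
  refine ⟨(2 * K / μ + 4 * K) + 2 * C * 2 ^ μ + 2 * C * (4 / |2 * Real.pi - δ|) ^ μ, ?_⟩
  rintro f u hf hfC hu hH z w ⟨r₁, s₁, h1, h1', hs₁, rfl⟩ ⟨r₂, s₂, h2, h2', hs₂, rfl⟩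
  have hder := pv_deriv_arc M μ δ C s₀ A hμ hδ hM hC hA0 hA f u hf hfC hu hH
  rw [← hKdef] at hder
  have hmem : ∀ r s : ℝ, 1 / 2 ≤ r → r < 1 → (r : ℂ) * Complex.exp (I * s) ∈ ball (0 : ℂ) 1 := by
    intro r s hr hr1
    simp [abs_of_nonneg (show 0 ≤ r by linarith), hr1]
  obtain ⟨d, hd⟩ : ∃ d, d =
    ‖(r₁ : ℂ) * Complex.exp (I * s₁) - (r₂ : ℂ) * Complex.exp (I * s₂)‖ := ⟨_, rfl⟩
  have hbd : ‖f ((r₁ : ℂ) * Complex.exp (I * s₁)) - f ((r₂ : ℂ) * Complex.exp (I * s₂))‖ ≤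
      2 * C := by
    have a := hfC _ (hmem r₁ s₁ h1 h1')
    have b := hfC _ (hmem r₂ s₂ h2 h2')
    have := norm_sub_le (f ((r₁ : ℂ) * Complex.exp (I * s₁)))
      (f ((r₂ : ℂ) * Complex.exp (I * s₂)))
    linarith
  rw [← hd, add_mul, add_mul]
  have hd0 : 0 ≤ d := hd ▸ norm_nonneg _
  have p1 : 0 ≤ (2 * K / μ + 4 * K) * d ^ μ := by positivity
  have p2 : 0 ≤ 2 * C * 2 ^ μ * d ^ μ := by positivity
  have p3 : 0 ≤ 2 * C * (4 / |2 * Real.pi - δ|) ^ μ * d ^ μ := by positivity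
  rcases hd0.eq_or_lt with hz | hdpos
  · have : (r₁ : ℂ) * Complex.exp (I * s₁) = (r₂ : ℂ) * Complex.exp (I * s₂) :=
      sub_eq_zero.1 (norm_eq_zero.1 (by rw [← hd, ← hz]))
    rw [this, sub_self, norm_zero]
    linarith
  by_cases hd1 : d < 1 / 2
  swap
  · push Not at hd1
    have : 1 ≤ (2 : ℝ) ^ μ * d ^ μ := by
      rw [← Real.mul_rpow (by norm_num) hd0]
      exact Real.one_le_rpow (by linarith) hμ0.le
    nlinarith
  by_cases hpi : |s₁ - s₂| ≤ Real.pi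
  · have := pv_hl μ K hμ hK (Set.Icc (s₀ - δ / 2) (s₀ + δ / 2)) (convex_Icc _ _) f hf
      (fun s hs => hder s (by rw [abs_le]; constructor <;> linarith [hs.1, hs.2])) r₁ r₂ s₁ s₂
      h1 h1' h2 h2' (by rw [abs_le] at hs₁; constructor <;> linarith [hs₁.1, hs₁.2])
      (by rw [abs_le] at hs₂; constructor <;> linarith [hs₂.1, hs₂.2]) hpi d hd hdpos hd1
    linarith
  push Not at hpi
  obtain ⟨n, hn⟩ := pv_shift s₂ s₁
  have hd' := hd
  rw [← pv_exp_shift s₂ n] at hd'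
  rw [abs_sub_comm] at hn
  rcases le_or_gt (2 * Real.pi) δ with hδ2 | hδ2
  · have := pv_hl μ K hμ hK Set.univ convex_univ f hf
      (fun s _ r hr hr1 => by
        obtain ⟨m, hm⟩ := pv_shift s s₀
        rw [← pv_exp_shift s m]
        exact hder _ (by linarith) r hr hr1) r₁ r₂ s₁ (s₂ + n * (2 * Real.pi))
      h1 h1' h2 h2' (Set.mem_univ _) (Set.mem_univ _) hn d hd' hdpos hd1
    rw [pv_exp_shift] at this
    linarith
  · have hlow := pv_lower r₁ r₂ s₁ _ (by linarith) (by linarith) hn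
    rw [← hd'] at hlow
    have hrr : 1 / 4 ≤ r₁ * r₂ := by nlinarith
    set x := s₁ - (s₂ + n * (2 * Real.pi)) with hx
    have hang : |x| ≤ 4 * d := by
      apply abs_le_of_sq_le_sq _ (by linarith)
      nlinarith [sq_nonneg x, sq_nonneg (r₁ - r₂)]
    have hsd : |s₁ - s₂| ≤ δ := by
      have := abs_sub_le s₁ s₀ s₂
      rw [abs_sub_comm s₀] at this
      linarith
    have hn0 : n ≠ 0 := by
      rintro rfl
      simp [hx] at hn
      linarith
    have hn1 : (1 : ℝ) ≤ |(n : ℝ)| := by exact_mod_cast Int.one_le_abs hn0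
    have hge : 2 * Real.pi - δ ≤ |x| := by
      have h3 : |(n : ℝ) * (2 * Real.pi)| ≤ |s₁ - s₂| + |x| := by
        rw [show (n : ℝ) * (2 * Real.pi) = (s₁ - s₂) - x by rw [hx]; ring]
        exact abs_sub _ _
      rw [abs_mul, abs_of_pos Real.two_pi_pos] at h3
      nlinarith [Real.pi_pos]
    have : 1 ≤ (4 / |2 * Real.pi - δ|) ^ μ * d ^ μ := by
      rw [← Real.mul_rpow (by positivity) hd0]
      apply Real.one_le_rpow _ hμ0.le
      rw [abs_of_pos (by linarith), div_mul_eq_mul_div, le_div_iff₀ (by linarith)]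
      linarith
    have h9 := mul_le_mul_of_nonneg_left this (show 0 ≤ 2 * C by linarith)
    rw [mul_one, ← mul_assoc] at h9
    linarith
end
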